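/- arXiv:0710.1324 — 2 statements merged into one kernel-verified Lean document; each statement's English description precedes it below -/
import Mathlib

section
/- Define F(s) = ∫₀^∞ (1 - e^{-1/(x+s)})/√x dx for s ≥ 0. Then F(0) = 2√π, and F(s) = 2√π - (√π/2)s + O(s²) as s → 0⁺. -/
open Real MeasureTheory Filter Asymptotics Topology

lemma hasDerivAt_one_sub_exp_neg_inv {y : ℝ} (hy : 0 < y) :
    HasDerivAt (fun y : ℝ => 1 - exp (-1 / y)) (-(exp (-1 / y) / y ^ 2)) y := by
  have h := (((hasDerivAt_const y (-1 : ℝ)).fun_div (hasDerivAt_id y) hy.ne').exp).const_sub 1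
  refine h.congr_deriv ?_
  simp only [id]
  field_simp
  ring

lemma hasDerivAt_neg_exp_neg_inv_div_sq {y : ℝ} (hy : 0 < y) :
    HasDerivAt (fun y : ℝ => -(exp (-1 / y) / y ^ 2))
      (exp (-1 / y) * (2 / y ^ 3 - 1 / y ^ 4)) y := by
  have h := ((((hasDerivAt_const y (-1 : ℝ)).fun_div (hasDerivAt_id y) hy.ne').exp).fun_div
    (hasDerivAt_pow 2 y) (pow_pos hy 2).ne').fun_neg
  refine h.congr_deriv ?_
  simp only [id]
  field_simp
  push_cast
  ring

lemma exp_neg_mul_pow_le_factorial {u : ℝ} (hu : 0 ≤ u) (n : ℕ) :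
    exp (-u) * u ^ n ≤ n.factorial := by
  have h := Real.pow_div_factorial_le_exp u hu n
  rw [div_le_iff₀ (by positivity)] at h
  rw [exp_neg, inv_mul_le_iff₀ (exp_pos u)]
  exact h

lemma abs_exp_neg_inv_mul_le {x y : ℝ} (hx : 0 < x) (hxy : x ≤ y) :
    |exp (-1 / y) * (2 / y ^ 3 - 1 / y ^ 4)| ≤ 36 * min 1 x⁻¹ := by
  have hy : 0 < y := hx.trans_le hxy
  obtain ⟨u, hu⟩ : ∃ u, u = y⁻¹ := ⟨_, rfl⟩
  have hu0 : 0 < u := by rw [hu]; positivity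
  have hux : u ≤ x⁻¹ := by rw [hu]; gcongr
  have he : exp (-1 / y) * (2 / y ^ 3 - 1 / y ^ 4) = exp (-u) * (2 * u ^ 3 - u ^ 4) := by
    rw [hu, neg_div, one_div, div_eq_mul_inv, one_div, inv_pow, inv_pow]
  have h4 := exp_neg_mul_pow_le_factorial hu0.le 4
  have h3 := exp_neg_mul_pow_le_factorial hu0.le 3
  have h2 := exp_neg_mul_pow_le_factorial hu0.le 2
  norm_num [Nat.factorial] at h2 h3 h4
  have hE := exp_pos (-u)
  have habs : |exp (-u) * (2 * u ^ 3 - u ^ 4)| ≤ exp (-u) * (2 * u ^ 3 + u ^ 4) := by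
    rw [abs_mul, abs_of_pos hE]
    gcongr
    rw [abs_le]
    constructor <;> nlinarith [pow_pos hu0 3, pow_pos hu0 4]
  rw [he, mul_min_of_nonneg _ _ (by norm_num)]
  refine habs.trans (le_min (by linarith) ?_)
  calc exp (-u) * (2 * u ^ 3 + u ^ 4)
      = u * (2 * (exp (-u) * u ^ 2) + exp (-u) * u ^ 3) := by ring
    _ ≤ u * 36 := by gcongr; linarith
    _ ≤ 36 * x⁻¹ := by linarith

lemma abs_taylor_remainder_le {x s : ℝ} (hx : 0 < x) (hs : 0 ≤ s) :
    |(1 - exp (-1 / (x + s))) - (1 - exp (-1 / x)) + s * (exp (-1 / x) / x ^ 2)|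
      ≤ 36 * min 1 x⁻¹ * s ^ 2 := by
  have hC : 0 ≤ 36 * min 1 x⁻¹ := by positivity
  have hderiv : ∀ y ∈ Set.Icc x (x + s),
      ‖-(exp (-1 / y) / y ^ 2) - -(exp (-1 / x) / x ^ 2)‖ ≤ 36 * min 1 x⁻¹ * s := by
    intro y hy
    have h := (convex_Icc x (x + s)).norm_image_sub_le_of_norm_hasDerivWithin_le
      (fun z hz => (hasDerivAt_neg_exp_neg_inv_div_sq (hx.trans_le hz.1)).hasDerivWithinAt)
      (fun z hz => abs_exp_neg_inv_mul_le hx hz.1)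
      (Set.left_mem_Icc.2 (by linarith)) hy
    refine h.trans ?_
    gcongr
    rw [Real.norm_eq_abs, abs_of_nonneg (by linarith [hy.1])]
    linarith [hy.2]
  have h := (convex_Icc x (x + s)).norm_image_sub_le_of_norm_hasDerivWithin_le
    (f := fun y => (1 - exp (-1 / y)) - y * -(exp (-1 / x) / x ^ 2))
    (fun z hz => ((hasDerivAt_one_sub_exp_neg_inv (hx.trans_le hz.1)).fun_sub
      (by simpa using (hasDerivAt_id z).mul_const (-(exp (-1 / x) / x ^ 2)))).hasDerivWithinAt)
    hderiv (Set.left_mem_Icc.2 (by linarith)) (Set.right_mem_Icc.2 (by linarith))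
  rw [Real.norm_eq_abs, Real.norm_eq_abs, add_sub_cancel_left, abs_of_nonneg hs] at h
  refine le_trans (le_of_eq ?_) (h.trans (le_of_eq (by ring)))
  congr 1
  ring

lemma integrableOn_min_one_inv_div_sqrt :
    IntegrableOn (fun x : ℝ => min 1 x⁻¹ / √x) (Set.Ioi 0) := by
  have hmeas : Measurable fun x : ℝ => min 1 x⁻¹ / √x := by fun_prop
  rw [← Set.Ioc_union_Ioi_eq_Ioi zero_le_one]
  refine IntegrableOn.union ?_ ?_
  · have h : IntegrableOn (fun x : ℝ => x ^ (-(1 / 2) : ℝ)) (Set.Ioc 0 1) :=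
      (intervalIntegrable_iff_integrableOn_Ioc_of_le zero_le_one).1
        (intervalIntegral.intervalIntegrable_rpow' (by norm_num))
    refine h.mono' hmeas.aestronglyMeasurable ?_
    filter_upwards [ae_restrict_mem measurableSet_Ioc] with x hx
    have hx0 := hx.1
    rw [Real.norm_of_nonneg (by positivity), rpow_neg hx0.le, ← sqrt_eq_rpow, div_eq_mul_inv]
    exact mul_le_of_le_one_left (by positivity) (min_le_left _ _)
  · have h : IntegrableOn (fun x : ℝ => x ^ (-(3 / 2) : ℝ)) (Set.Ioi 1) :=
      integrableOn_Ioi_rpow_of_lt (by norm_num) one_pos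
    refine h.mono' hmeas.aestronglyMeasurable ?_
    filter_upwards [ae_restrict_mem measurableSet_Ioi] with x hx
    have hx0 : 0 < x := one_pos.trans hx
    rw [Real.norm_of_nonneg (by positivity), show (-(3 / 2) : ℝ) = -1 + -(1 / 2) by norm_num,
      rpow_add hx0, rpow_neg_one, rpow_neg hx0.le, ← sqrt_eq_rpow, div_eq_mul_inv]
    gcongr
    exact min_le_right _ _

lemma one_sub_exp_neg_inv_nonneg {y : ℝ} (hy : 0 < y) : 0 ≤ 1 - exp (-1 / y) := by
  rw [sub_nonneg, exp_le_one_iff]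
  exact div_nonpos_of_nonpos_of_nonneg (by norm_num) hy.le

lemma one_sub_exp_neg_inv_le {y : ℝ} : 1 - exp (-1 / y) ≤ min 1 y⁻¹ := by
  refine le_min (by linarith [exp_pos (-1 / y)]) ?_
  have h := add_one_le_exp (-1 / y)
  rw [neg_div, one_div] at *
  linarith

lemma integrableOn_one_sub_exp_div_sqrt {s : ℝ} (hs : 0 ≤ s) :
    IntegrableOn (fun x : ℝ => (1 - exp (-1 / (x + s))) / √x) (Set.Ioi 0) := by
  have hmeas : Measurable fun x : ℝ => (1 - exp (-1 / (x + s))) / √x := by fun_prop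
  refine integrableOn_min_one_inv_div_sqrt.mono' hmeas.aestronglyMeasurable ?_
  filter_upwards [ae_restrict_mem measurableSet_Ioi] with x hx
  have hx0 : 0 < x := hx
  have h0 := one_sub_exp_neg_inv_nonneg (add_pos_of_pos_of_nonneg hx0 hs)
  rw [Real.norm_of_nonneg (by positivity)]
  gcongr
  refine one_sub_exp_neg_inv_le.trans (min_le_min_left _ ?_)
  gcongr
  linarith

lemma exp_neg_inv_mul_rpow_eq {a x : ℝ} (hx : 0 < x) :
    (|(-1 : ℝ)| * x ^ ((-1 : ℝ) - 1)) • (exp (-x ^ (-1 : ℝ)) * (x ^ (-1 : ℝ)) ^ (a - 1))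
      = exp (-1 / x) * x ^ (-a - 1) := by
  rw [← rpow_mul hx.le, rpow_neg_one, neg_div, one_div, smul_eq_mul, abs_neg, abs_one, one_mul,
    mul_left_comm, ← rpow_add hx]
  ring_nf

lemma integrableOn_exp_neg_inv_mul_rpow {a : ℝ} (ha : 0 < a) :
    IntegrableOn (fun x : ℝ => exp (-1 / x) * x ^ (-a - 1)) (Set.Ioi 0) := by
  have h := (integrableOn_Ioi_comp_rpow_iff (fun u => exp (-u) * u ^ (a - 1))
    (by norm_num : (-1 : ℝ) ≠ 0)).2 (GammaIntegral_convergent ha)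
  exact h.congr_fun (fun x hx => exp_neg_inv_mul_rpow_eq hx) measurableSet_Ioi

lemma integral_exp_neg_inv_mul_rpow {a : ℝ} (ha : 0 < a) :
    ∫ x in Set.Ioi (0 : ℝ), exp (-1 / x) * x ^ (-a - 1) = Gamma a := by
  rw [Gamma_eq_integral ha, ← integral_comp_rpow_Ioi (fun u => exp (-u) * u ^ (a - 1))
    (by norm_num : (-1 : ℝ) ≠ 0)]
  exact setIntegral_congr_fun measurableSet_Ioi fun x hx => (exp_neg_inv_mul_rpow_eq hx).symm

lemma exp_neg_inv_div_sq_div_sqrt_eq {x : ℝ} (hx : 0 < x) :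
    exp (-1 / x) / x ^ 2 / √x = exp (-1 / x) * x ^ (-(3 / 2) - 1 : ℝ) := by
  rw [show (-(3 / 2) - 1 : ℝ) = -(2 : ℕ) + -(1 / 2) by norm_num, rpow_add hx, rpow_neg hx.le,
    rpow_neg hx.le, rpow_natCast, ← sqrt_eq_rpow]
  ring

lemma integrableOn_exp_neg_inv_div_sq_div_sqrt :
    IntegrableOn (fun x : ℝ => exp (-1 / x) / x ^ 2 / √x) (Set.Ioi 0) :=
  (integrableOn_exp_neg_inv_mul_rpow (by norm_num : (0 : ℝ) < 3 / 2)).congr_fun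
    (fun _ hx => (exp_neg_inv_div_sq_div_sqrt_eq hx).symm) measurableSet_Ioi

lemma integral_exp_neg_inv_div_sq_div_sqrt :
    ∫ x in Set.Ioi (0 : ℝ), exp (-1 / x) / x ^ 2 / √x = √π / 2 := by
  rw [setIntegral_congr_fun measurableSet_Ioi fun x hx => exp_neg_inv_div_sq_div_sqrt_eq hx,
    integral_exp_neg_inv_mul_rpow (by norm_num), show (3 / 2 : ℝ) = 1 / 2 + 1 by norm_num,
    Gamma_add_one (by norm_num), Gamma_one_half_eq]
  ring

lemma integral_one_sub_exp_neg_inv_div_sqrt :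
    ∫ x in Set.Ioi (0 : ℝ), (1 - exp (-1 / x)) / √x = 2 * √π := by
  have hF : IntegrableOn (fun x : ℝ => (1 - exp (-1 / x)) / √x) (Set.Ioi 0) := by
    simpa using integrableOn_one_sub_exp_div_sqrt le_rfl
  have hG := (integrableOn_exp_neg_inv_mul_rpow (by norm_num : (0 : ℝ) < 1 / 2)).const_mul 2
  have hd : ∀ x ∈ Set.Ioi (0 : ℝ), HasDerivAt (fun x => 2 * √x * (1 - exp (-1 / x)))
      ((1 - exp (-1 / x)) / √x - 2 * (exp (-1 / x) * x ^ (-(1 / 2) - 1 : ℝ))) x := by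
    intro x hx
    have hx0 : 0 < x := hx
    refine (((hasDerivAt_sqrt hx0.ne').const_mul 2).fun_mul
      (hasDerivAt_one_sub_exp_neg_inv hx0)).congr_deriv ?_
    rw [show (-(1 / 2) - 1 : ℝ) = -(2 : ℕ) + 1 / 2 by norm_num, rpow_add hx0, rpow_neg hx0.le,
      rpow_natCast, ← sqrt_eq_rpow]
    field_simp
    ring
  have hbound : ∀ x : ℝ, 0 < x → 0 ≤ 2 * √x * (1 - exp (-1 / x)) := fun x hx =>
    mul_nonneg (by positivity) (one_sub_exp_neg_inv_nonneg hx)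
  have hc : ContinuousWithinAt (fun x : ℝ => 2 * √x * (1 - exp (-1 / x))) (Set.Ici 0) 0 := by
    rw [← continuousWithinAt_Ioi_iff_Ici, ContinuousWithinAt]
    have hlim : Tendsto (fun x : ℝ => 2 * √x) (𝓝[>] 0) (𝓝 0) := by
      have : Continuous fun x : ℝ => 2 * √x := by fun_prop
      simpa using (this.tendsto 0).mono_left nhdsWithin_le_nhds
    simp only [sqrt_zero, mul_zero, zero_mul]
    refine tendsto_of_tendsto_of_tendsto_of_le_of_le' tendsto_const_nhds hlim ?_ ?_
    · filter_upwards [self_mem_nhdsWithin] with x hx using hbound x hx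
    · filter_upwards with x
      exact mul_le_of_le_one_right (by positivity) (by linarith [exp_pos (-1 / x)])
  have ht : Tendsto (fun x : ℝ => 2 * √x * (1 - exp (-1 / x))) atTop (𝓝 0) := by
    have hlim : Tendsto (fun x : ℝ => 2 * (√x)⁻¹) atTop (𝓝 0) := by
      simpa using (tendsto_inv_atTop_zero.comp tendsto_sqrt_atTop).const_mul (2 : ℝ)
    refine tendsto_of_tendsto_of_tendsto_of_le_of_le' tendsto_const_nhds hlim ?_ ?_
    · filter_upwards [eventually_gt_atTop 0] with x hx using hbound x hx
    · filter_upwards [eventually_gt_atTop 0] with x hx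
      calc 2 * √x * (1 - exp (-1 / x)) ≤ 2 * √x * x⁻¹ := by
            gcongr
            exact one_sub_exp_neg_inv_le.trans (min_le_right _ _)
        _ = 2 * (√x)⁻¹ := by
            have := sq_sqrt hx.le
            field_simp
            exact this
  have h := integral_Ioi_of_hasDerivAt_of_tendsto hc hd (hF.sub hG) ht
  rw [integral_sub hF hG, integral_const_mul, integral_exp_neg_inv_mul_rpow (by norm_num),
    Gamma_one_half_eq] at h
  simp only [sqrt_zero, mul_zero, zero_mul, sub_zero] at h
  linarith

theorem F_value_and_expansion :
    (∫ x in Set.Ioi (0:ℝ), (1 - Real.exp (-1 / x)) / Real.sqrt x) = 2 * Real.sqrt π ∧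
      (fun s : ℝ =>
          (∫ x in Set.Ioi (0:ℝ), (1 - Real.exp (-1 / (x + s))) / Real.sqrt x) -
            (2 * Real.sqrt π - (Real.sqrt π / 2) * s))
        =O[𝓝[>] 0] fun s : ℝ => s ^ 2 := by
  refine ⟨integral_one_sub_exp_neg_inv_div_sqrt, ?_⟩
  refine IsBigO.of_bound (36 * ∫ x in Set.Ioi (0 : ℝ), min 1 x⁻¹ / √x) ?_
  filter_upwards [self_mem_nhdsWithin] with s hs
  have hs0 : 0 ≤ s := le_of_lt hs
  have hFs := integrableOn_one_sub_exp_div_sqrt hs0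
  have hF : IntegrableOn (fun x : ℝ => (1 - exp (-1 / x)) / √x) (Set.Ioi 0) := by
    simpa using integrableOn_one_sub_exp_div_sqrt le_rfl
  have hG := integrableOn_exp_neg_inv_div_sq_div_sqrt.const_mul s
  have heq : (∫ x in Set.Ioi (0 : ℝ), (1 - exp (-1 / (x + s))) / √x) - (2 * √π - √π / 2 * s)
      = ∫ x in Set.Ioi (0 : ℝ), ((1 - exp (-1 / (x + s))) / √x - (1 - exp (-1 / x)) / √x
          + s * (exp (-1 / x) / x ^ 2 / √x)) := by
    rw [integral_add (hFs.fun_sub hF) hG, integral_sub hFs hF, integral_const_mul,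
      integral_exp_neg_inv_div_sq_div_sqrt, integral_one_sub_exp_neg_inv_div_sqrt]
    ring
  rw [heq, norm_of_nonneg (sq_nonneg s), ← integral_const_mul, ← integral_mul_const]
  refine norm_integral_le_of_norm_le
    ((integrableOn_min_one_inv_div_sqrt.const_mul 36).mul_const (s ^ 2)) ?_
  filter_upwards [ae_restrict_mem measurableSet_Ioi] with x hx
  have hx0 : 0 < x := hx
  have h := abs_taylor_remainder_le hx0 hs0
  calc ‖(1 - exp (-1 / (x + s))) / √x - (1 - exp (-1 / x)) / √x
          + s * (exp (-1 / x) / x ^ 2 / √x)‖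
      = |(1 - exp (-1 / (x + s))) - (1 - exp (-1 / x)) + s * (exp (-1 / x) / x ^ 2)| / √x := by
        rw [← abs_of_nonneg (sqrt_nonneg x), ← abs_div, abs_of_nonneg (sqrt_nonneg x),
          Real.norm_eq_abs]
        congr 1
        ring
    _ ≤ 36 * min 1 x⁻¹ * s ^ 2 / √x := by gcongr
    _ = 36 * (min 1 x⁻¹ / √x) * s ^ 2 := by ring
end

section
/- For t > 0 and ε > 0, the integral I₁(t, ε) = ∫₀^ε ∫₀^π e^{-(r²/(2t))(1-cos θ)} dθ · 2r dr satisfies I₁(t, ε) = ε√(4πt)·(1 - (1/4)(t/ε²) + O((t/ε²)²)) as t → 0⁺. -/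
open Real MeasureTheory Filter Asymptotics Topology

theorem abs_sqrt_one_sub_sq_sub_le (s : ℝ) :
    |√(1 - s ^ 2) - (1 - s ^ 2 / 2)| ≤ s ^ 4 := by
  rcases le_total (s ^ 2) 1 with h | h
  · have hu : 0 ≤ 1 - s ^ 2 := by linarith
    have h1 : √(1 - s ^ 2) ≤ 1 - s ^ 2 / 2 :=
      Real.sqrt_le_iff.2 ⟨by linarith, by nlinarith [sq_nonneg (s ^ 2)]⟩
    have h2 : 1 - s ^ 2 / 2 - s ^ 4 / 2 ≤ √(1 - s ^ 2) := by
      refine Real.le_sqrt_of_sq_le ?_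
      have : 0 ≤ (1 - s ^ 2) * (s ^ 4) * (3 + s ^ 2) := by positivity
      nlinarith
    rw [abs_le]
    constructor <;> nlinarith [sq_nonneg (s ^ 2)]
  · rw [Real.sqrt_eq_zero_of_nonpos (by linarith), abs_le]
    constructor <;> nlinarith

theorem integral_Ioi_even_pow_mul_exp_neg_mul_sq (n : ℕ) {b : ℝ} (hb : 0 < b) :
    ∫ s in Set.Ioi (0 : ℝ), s ^ (2 * n) * Real.exp (-b * s ^ 2) =
      ((Nat.doubleFactorial (2 * n - 1) : ℝ) / (2 * (2 * b) ^ n)) * √(π / b) := by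
  have h := integral_rpow_mul_exp_neg_mul_rpow (p := 2) (q := (2 * n : ℕ)) two_pos
    (by linarith [Nat.cast_nonneg (α := ℝ) (2 * n)]) hb
  simp only [Real.rpow_natCast, Real.rpow_two] at h
  rw [h]
  have e : (((2 * n : ℕ) : ℝ) + 1) / 2 = n + 1 / 2 := by push_cast; ring
  rw [neg_div, e, Real.Gamma_nat_add_half, Real.rpow_neg hb.le, Real.rpow_add hb,
    Real.rpow_natCast, ← Real.sqrt_eq_rpow, Real.sqrt_div pi_pos.le, mul_pow]
  have : 0 < √b := Real.sqrt_pos.2 hb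
  field_simp

theorem integrableOn_Ioi_pow_mul_exp_neg_mul_sq (n : ℕ) {b : ℝ} (hb : 0 < b) :
    IntegrableOn (fun s : ℝ => s ^ n * Real.exp (-b * s ^ 2)) (Set.Ioi 0) := by
  simpa using integrableOn_rpow_mul_exp_neg_mul_sq hb (s := n)
    (by linarith [Nat.cast_nonneg (α := ℝ) n])

/-- Second-order Laplace expansion of the integral of `exp (-b s ^ 2) * √(1 - s ^ 2)`. -/
theorem abs_integral_exp_mul_sqrt_sub_le {b : ℝ} (hb : 0 < b) :
    |(∫ s in Set.Ioi (0 : ℝ), Real.exp (-b * s ^ 2) * √(1 - s ^ 2)) -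
      √(π / b) / 2 * (1 - 1 / (4 * b))| ≤ 3 / (8 * b ^ 2) * √(π / b) := by
  have i0 := integrableOn_Ioi_pow_mul_exp_neg_mul_sq 0 hb
  have i2 := integrableOn_Ioi_pow_mul_exp_neg_mul_sq 2 hb
  have i4 := integrableOn_Ioi_pow_mul_exp_neg_mul_sq 4 hb
  have m0 := integral_Ioi_even_pow_mul_exp_neg_mul_sq 0 hb
  have m2 := integral_Ioi_even_pow_mul_exp_neg_mul_sq 1 hb
  have m4 := integral_Ioi_even_pow_mul_exp_neg_mul_sq 2 hb
  norm_num [Nat.doubleFactorial] at m0 m2 m4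
  simp only [pow_zero, one_mul, neg_mul] at i0 i2 i4
  have hs : IntegrableOn (fun s : ℝ => Real.exp (-b * s ^ 2) * √(1 - s ^ 2)) (Set.Ioi 0) := by
    refine Integrable.mono' (g := fun s => Real.exp (-(b * s ^ 2))) i0
      (by fun_prop) (.of_forall fun s => ?_)
    rw [norm_mul, Real.norm_of_nonneg (Real.exp_pos _).le, neg_mul,
      Real.norm_of_nonneg (Real.sqrt_nonneg _)]
    exact mul_le_of_le_one_right (Real.exp_pos _).le
      (Real.sqrt_le_one.2 (by linarith [sq_nonneg s]))
  have hq : IntegrableOn (fun s : ℝ => Real.exp (-(b * s ^ 2)) -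
      (1 / 2) * (s ^ 2 * Real.exp (-(b * s ^ 2)))) (Set.Ioi 0) :=
    i0.sub (i2.const_mul (1 / 2))
  have hmain : √(π / b) / 2 * (1 - 1 / (4 * b)) = ∫ s in Set.Ioi (0 : ℝ),
      (Real.exp (-(b * s ^ 2)) - (1 / 2) * (s ^ 2 * Real.exp (-(b * s ^ 2)))) := by
    rw [integral_sub i0 (i2.const_mul (1 / 2)), integral_const_mul, m0, m2]
    field_simp
    ring
  have herr : 3 / (8 * b ^ 2) * √(π / b) =
      ∫ s in Set.Ioi (0 : ℝ), s ^ 4 * Real.exp (-(b * s ^ 2)) := by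
    rw [m4]; field_simp; norm_num
  rw [hmain, ← integral_sub hs hq, herr, ← Real.norm_eq_abs]
  refine norm_integral_le_of_norm_le i4 (.of_forall fun s => ?_)
  have : Real.exp (-b * s ^ 2) * √(1 - s ^ 2) - (Real.exp (-(b * s ^ 2)) -
      (1 / 2) * (s ^ 2 * Real.exp (-(b * s ^ 2)))) =
      (√(1 - s ^ 2) - (1 - s ^ 2 / 2)) * Real.exp (-(b * s ^ 2)) := by
    rw [neg_mul]; ring
  rw [this, norm_mul, Real.norm_of_nonneg (Real.exp_pos _).le, Real.norm_eq_abs]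
  gcongr
  exact abs_sqrt_one_sub_sq_sub_le s

theorem integral_exp_mul_one_add_cos (x : ℝ) :
    ∫ θ in (0:ℝ)..π, Real.exp (-x * (1 - Real.cos θ)) * (1 + Real.cos θ) =
      4 * ∫ s in Set.Ioi (0 : ℝ), Real.exp (-(2 * x) * s ^ 2) * √(1 - s ^ 2) := by
  have hsub := intervalIntegral.integral_comp_mul_deriv (a := 0) (b := π)
    (f := fun θ => Real.sin (θ / 2)) (f' := fun θ => Real.cos (θ / 2) * (1 / 2))
    (g := fun s => Real.exp (-(2 * x) * s ^ 2) * √(1 - s ^ 2))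
    (fun θ _ => ((hasDerivAt_id θ).div_const 2).sin) (by fun_prop) (by fun_prop)
  have hI : ∫ s in Set.Ioi (0 : ℝ), Real.exp (-(2 * x) * s ^ 2) * √(1 - s ^ 2) =
      ∫ s in (0:ℝ)..1, Real.exp (-(2 * x) * s ^ 2) * √(1 - s ^ 2) := by
    rw [intervalIntegral.integral_of_le zero_le_one]
    refine setIntegral_eq_of_subset_of_forall_sdiff_eq_zero measurableSet_Ioi
      Set.Ioc_subset_Ioi_self fun s hs => ?_
    have h1 : 1 < s := by
      by_contra! h
      exact hs.2 ⟨hs.1, h⟩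
    rw [Real.sqrt_eq_zero_of_nonpos (by nlinarith), mul_zero]
  simp only [zero_div, Real.sin_zero, Real.sin_pi_div_two] at hsub
  rw [hI, ← hsub, ← intervalIntegral.integral_const_mul]
  refine intervalIntegral.integral_congr fun θ hθ => ?_
  rw [Set.uIcc_of_le pi_pos.le] at hθ
  have hc : 0 ≤ Real.cos (θ / 2) :=
    Real.cos_nonneg_of_mem_Icc ⟨by linarith [hθ.1, pi_pos], by linarith [hθ.2]⟩
  have hcos : Real.cos θ = 2 * Real.cos (θ / 2) ^ 2 - 1 := by
    rw [← Real.cos_two_mul]; ring_nf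
  have hsq : 1 - Real.sin (θ / 2) ^ 2 = Real.cos (θ / 2) ^ 2 := by
    linarith [Real.sin_sq_add_cos_sq (θ / 2)]
  have hexp : -x * (1 - Real.cos θ) = -(2 * x) * Real.sin (θ / 2) ^ 2 := by
    rw [hcos]; linear_combination -(2 * x) * hsq
  simp only [Function.comp_apply]
  rw [hsq, Real.sqrt_sq hc, hexp, hcos]
  ring

/-- The radial-angular integral reduces to a single angular integral, because
`∂_r (r² (1 + cos θ) e) - ∂_θ (2 r sin θ e) = 2 r e` for `e = exp (-c r² (1 - cos θ))`. -/
theorem integral_integral_exp_mul_two_mul (c ε : ℝ) :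
    ∫ r in (0:ℝ)..ε, (∫ θ in (0:ℝ)..π, Real.exp (-(c * r ^ 2) * (1 - Real.cos θ))) * (2 * r) =
      ε ^ 2 * ∫ θ in (0:ℝ)..π, Real.exp (-(c * ε ^ 2) * (1 - Real.cos θ)) * (1 + Real.cos θ) := by
  set E : ℝ → ℝ → ℝ := fun r θ => Real.exp (-(c * r ^ 2) * (1 - Real.cos θ)) with hE
  set D : ℝ → ℝ → ℝ := fun r θ =>
    (2 * r - 2 * c * r ^ 3 * (1 - Real.cos θ)) * (1 + Real.cos θ) * E r θ with hD
  have hDr (r θ : ℝ) : HasDerivAt (fun r => r ^ 2 * (E r θ * (1 + Real.cos θ))) (D r θ) r := by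
    have := (hasDerivAt_pow 2 r).mul
      ((((((hasDerivAt_pow 2 r).const_mul c).neg.mul_const (1 - Real.cos θ)).exp).mul_const
        (1 + Real.cos θ)))
    refine this.congr_deriv ?_
    simp only [hD, hE, Pi.neg_apply]
    push_cast
    ring
  have hDθ (r θ : ℝ) : HasDerivAt (fun θ => 2 * r * (Real.sin θ * E r θ))
      (D r θ - E r θ * (2 * r)) θ := by
    have := (((Real.hasDerivAt_sin θ).mul
      ((((Real.hasDerivAt_cos θ).const_sub 1).const_mul (-(c * r ^ 2))).exp)).const_mul (2 * r))
    refine this.congr_deriv ?_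
    simp only [hD, hE]
    linear_combination (-2 * c * r ^ 3 * Real.exp (-(c * r ^ 2) * (1 - Real.cos θ))) *
      Real.sin_sq_add_cos_sq θ
  have hDc : Continuous fun p : ℝ × ℝ => D p.1 p.2 := by fun_prop
  have hinner (r : ℝ) : (∫ θ in (0:ℝ)..π, E r θ) * (2 * r) = ∫ θ in (0:ℝ)..π, D r θ := by
    have iD : IntervalIntegrable (fun θ => D r θ) volume 0 π :=
      Continuous.intervalIntegrable (by fun_prop) _ _
    have iE : IntervalIntegrable (fun θ => E r θ * (2 * r)) volume 0 π :=
      Continuous.intervalIntegrable (by fun_prop) _ _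
    have h := intervalIntegral.integral_eq_sub_of_hasDerivAt (fun θ _ => hDθ r θ) (iD.sub iE)
    rw [intervalIntegral.integral_sub iD iE, intervalIntegral.integral_mul_const] at h
    simp only [Real.sin_pi, Real.sin_zero, zero_mul, mul_zero, sub_zero] at h
    linarith
  refine (intervalIntegral.integral_congr fun r _ => hinner r).trans ?_
  rw [intervalIntegral_intervalIntegral_swap, ← intervalIntegral.integral_const_mul]
  · refine intervalIntegral.integral_congr fun θ _ => ?_
    rw [intervalIntegral.integral_eq_sub_of_hasDerivAt (fun r _ => hDr r θ)
      (Continuous.intervalIntegrable (by fun_prop) _ _)]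
    simp [hE]
  · refine IntegrableOn.mono_set (t := Set.uIcc 0 ε ×ˢ Set.uIcc 0 π) ?_ ?_
    · exact hDc.continuousOn.integrableOn_compact (isCompact_uIcc.prod isCompact_uIcc)
    · exact Set.prod_mono Set.uIoc_subset_uIcc Set.uIoc_subset_uIcc

theorem I1_asymptotics (ε : ℝ) (hε : 0 < ε) :
    (fun t : ℝ =>
        (∫ r in (0:ℝ)..ε,
            (∫ θ in (0:ℝ)..π, Real.exp (-(r ^ 2 / (2 * t)) * (1 - Real.cos θ))) * (2 * r)) -
          ε * Real.sqrt (4 * π * t) * (1 - (1 / 4) * (t / ε ^ 2)))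
      =O[𝓝[>] 0] fun t : ℝ => Real.sqrt (4 * π * t) * (t / ε ^ 2) ^ 2 := by
  refine IsBigO.of_bound (3 / 4 * ε) ?_
  filter_upwards [self_mem_nhdsWithin] with t (ht : 0 < t)
  have hrw (r : ℝ) : r ^ 2 / (2 * t) = 1 / (2 * t) * r ^ 2 := by ring
  simp only [hrw]
  rw [integral_integral_exp_mul_two_mul, integral_exp_mul_one_add_cos]
  have hb : 2 * (1 / (2 * t) * ε ^ 2) = ε ^ 2 / t := by field_simp
  have h := abs_integral_exp_mul_sqrt_sub_le (b := ε ^ 2 / t) (by positivity)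
  have hs : √(π / (ε ^ 2 / t)) = √(4 * π * t) / (2 * ε) := by
    rw [show π / (ε ^ 2 / t) = 4 * π * t / (2 * ε) ^ 2 by field_simp; norm_num,
      Real.sqrt_div (by positivity), Real.sqrt_sq (by positivity)]
  rw [hs] at h
  rw [hb, Real.norm_eq_abs, Real.norm_of_nonneg (by positivity)]
  set J := ∫ s in Set.Ioi (0 : ℝ), Real.exp (-(ε ^ 2 / t) * s ^ 2) * √(1 - s ^ 2)
  calc _ = 4 * ε ^ 2 * |J - √(4 * π * t) / (2 * ε) / 2 * (1 - 1 / (4 * (ε ^ 2 / t)))| := by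
        rw [← abs_of_pos (show 0 < 4 * ε ^ 2 by positivity), ← abs_mul]
        congr 1
        field_simp
        ring
    _ ≤ 4 * ε ^ 2 * (3 / (8 * (ε ^ 2 / t) ^ 2) * (√(4 * π * t) / (2 * ε))) := by gcongr
    _ = _ := by
        field_simp
        norm_num
end
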